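/- arXiv:1912.02378 — 6 statements merged into one kernel-verified Lean document; each statement's English description precedes it below -/
import Mathlib

section
/- For a graph G, det(Q(G)) = 4 if and only if G is an odd unicyclic graph (a connected graph whose number of edges equals its number of vertices and whose unique cycle has odd length). -/
open Matrix SimpleGraph Polynomial

/-- The signless Laplacian matrix Q(G) = D(G) + A(G). -/
noncomputable def signlessLaplacian {V : Type*} [Fintype V] [DecidableEq V]
    (G : SimpleGraph V) [DecidableRel G.Adj] : Matrix V V ℝ :=
  Matrix.diagonal (fun v => (G.degree v : ℝ)) + G.adjMatrix ℝ

/-- Eigenvalues (roots of the characteristic polynomial, with multiplicity),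
sorted in non-increasing order. -/
noncomputable def eigsDesc {V : Type*} [Fintype V] [DecidableEq V] (M : Matrix V V ℝ) : List ℝ :=
  (M.charpoly.roots.sort (· ≤ ·)).reverse

/-- Vertex degrees sorted in non-increasing order. -/
noncomputable def degsDesc {V : Type*} [Fintype V] [DecidableEq V]
    (G : SimpleGraph V) [DecidableRel G.Adj] : List ℕ :=
  ((Finset.univ.val.map fun v => G.degree v).sort (· ≤ ·)).reverse

namespace OddUni

variable {V : Type*} [Fintype V] [DecidableEq V]

/-- Edge-indexed integer incidence matrix. -/
def inc (G : SimpleGraph V) : Matrix V G.edgeSet ℤ :=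
  Matrix.of fun v e => if v ∈ e.1 then 1 else 0

/-- Change of basis with columns `e_v + e_r`. -/
def bas (r : V) : Matrix V V ℤ :=
  1 + replicateCol Unit (Pi.single r 1 : V → ℤ) * replicateRow Unit (fun _ : V => (1 : ℤ))

/-- The incidence matrix in the basis `bas r`. -/
def red (G : SimpleGraph V) (r : V) : Matrix V G.edgeSet ℤ :=
  Matrix.of fun v e => inc G v e - if v = r then 1 else 0

lemma vecMul_inc (G : SimpleGraph V) (f : V → ℤ) (u v : V) (h : s(u, v) ∈ G.edgeSet) :
    (f ᵥ* inc G) ⟨s(u, v), h⟩ = f u + f v := by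
  have huv : u ≠ v := G.ne_of_adj h
  have : ∀ x, f x * inc G x ⟨s(u, v), h⟩
      = (if x = u then f x else 0) + (if x = v then f x else 0) := by
    intro x
    simp only [inc, Matrix.of_apply, Sym2.mem_iff]
    by_cases h1 : x = u <;> by_cases h2 : x = v <;> simp_all
  simp [vecMul, dotProduct, this, Finset.sum_add_distrib]

lemma vecMul_red (G : SimpleGraph V) (r : V) (f : V → ℤ) (u v : V) (h : s(u, v) ∈ G.edgeSet) :
    (f ᵥ* red G r) ⟨s(u, v), h⟩ = f u + f v - f r := by
  rw [← vecMul_inc G f u v h]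
  simp [vecMul, dotProduct, red, mul_sub, Finset.sum_sub_distrib]

lemma det_bas (r : V) : (bas r).det = 2 := by
  rw [bas, det_one_add_replicateCol_mul_replicateRow]
  simp [dotProduct]

lemma bas_apply (r i v : V) : bas r i v = (if i = v then 1 else 0) + if i = r then 1 else 0 := by
  simp [bas, Matrix.mul_apply, Matrix.one_apply, Pi.single_apply]

lemma bas_mul_red (G : SimpleGraph V) (r : V) : bas r * red G r = inc G := by
  ext i ⟨e, he⟩
  induction e using Sym2.ind with
  | _ u v =>
    have h1 := vecMul_red G r (fun _ => 1) u v he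
    have h2 : (bas r * red G r) i ⟨s(u, v), he⟩ = red G r i ⟨s(u, v), he⟩ +
        if i = r then ((fun _ => 1) ᵥ* red G r) ⟨s(u, v), he⟩ else 0 := by
      rw [Matrix.mul_apply]
      simp only [bas_apply, add_mul, Finset.sum_add_distrib]
      by_cases hi : i = r <;> simp [hi, vecMul, dotProduct]
    rw [h2, h1]
    simp [red]

lemma inc_mul_transpose (G : SimpleGraph V) [DecidableRel G.Adj] [Fintype G.edgeSet] :
    signlessLaplacian G = (inc G * (inc G)ᵀ).map (Int.castRingHom ℝ) := by
  have h1 : ∀ a b, (inc G * (inc G)ᵀ) a b = (G.incMatrix ℤ * (G.incMatrix ℤ)ᵀ) a b := by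
    intro a b
    rw [Matrix.mul_apply, Matrix.mul_apply]
    rw [← Finset.sum_subset (Finset.subset_univ G.edgeFinset)]
    · rw [← Finset.sum_subtype (F := inferInstance) G.edgeFinset (p := fun e => e ∈ G.edgeSet)
        (fun x => by simp) (f := fun e => G.incMatrix ℤ a e * (G.incMatrix ℤ)ᵀ e b) |>.symm]
      refine Finset.sum_congr rfl ?_
      rintro ⟨e, he⟩ -
      simp [inc, incMatrix_apply', incidenceSet, he]
    · intro e _ he
      have : e ∉ G.edgeSet := by simpa using he
      simp [incMatrix_apply', incidenceSet, this]
  ext a b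
  rw [Matrix.map_apply, h1, incMatrix_mul_transpose]
  by_cases hab : a = b
  · subst hab
    simp [signlessLaplacian]
  · simp [signlessLaplacian, hab, adjMatrix_apply]

lemma det_signless (G : SimpleGraph V) [DecidableRel G.Adj] [Fintype G.edgeSet] :
    (signlessLaplacian G).det = (((inc G * (inc G)ᵀ).det : ℤ) : ℝ) := by
  rw [inc_mul_transpose]
  exact ((Int.castRingHom ℝ).map_det _).symm

lemma det_inc (G : SimpleGraph V) [Fintype G.edgeSet] (r : V) :
    (inc G * (inc G)ᵀ).det = 4 * (red G r * (red G r)ᵀ).det := by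
  rw [← bas_mul_red G r, Matrix.transpose_mul]
  have : bas r * red G r * ((red G r)ᵀ * (bas r)ᵀ)
      = bas r * (red G r * (red G r)ᵀ) * (bas r)ᵀ := by
    simp only [Matrix.mul_assoc]
  rw [this, det_mul, det_mul, det_transpose, det_bas]
  ring

/-- An integer matrix with unimodular Gram matrix and no zero column is square. -/
lemma card_eq_of_gram {E : Type*} [Fintype E] (M : Matrix V E ℤ)
    (hdet : (M * Mᵀ).det = 1) (hcol : ∀ e, ∃ v, M v e ≠ 0) :
    Fintype.card E = Fintype.card V := by
  classical
  have hu : IsUnit (M * Mᵀ).det := by rw [hdet]; exact isUnit_one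
  set R := M * Mᵀ with hR
  set P : Matrix E E ℤ := Mᵀ * R⁻¹ * M with hP
  have hRs : Rᵀ = R := by simp [hR, Matrix.transpose_mul]
  have hPs : Pᵀ = P := by
    simp only [hP, Matrix.transpose_mul, Matrix.transpose_transpose, Matrix.transpose_nonsing_inv,
      hRs, Matrix.mul_assoc]
  have hMP : M * P = M := by
    calc M * P = (M * Mᵀ) * R⁻¹ * M := by simp only [hP, Matrix.mul_assoc]
      _ = M := by rw [← hR, Matrix.mul_nonsing_inv _ hu, Matrix.one_mul]
  have hPP : P * P = P := by
    calc P * P = Mᵀ * R⁻¹ * (M * P) := by simp only [hP, Matrix.mul_assoc]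
      _ = P := by rw [hMP]
  have htr : P.trace = Fintype.card V := by
    calc P.trace = (M * (Mᵀ * R⁻¹)).trace := by rw [hP, Matrix.trace_mul_comm]
      _ = _ := by
        rw [← Matrix.mul_assoc, ← hR, Matrix.mul_nonsing_inv _ hu, Matrix.trace_one]
  have hdiag : ∀ i, P i i = 1 := by
    intro i
    have h1 : P i i = ∑ j, P i j ^ 2 := by
      conv_lhs => rw [← hPP, Matrix.mul_apply]
      refine Finset.sum_congr rfl fun j _ => ?_
      have : P j i = P i j := by conv_lhs => rw [← hPs, Matrix.transpose_apply]
      rw [this, sq]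
    have h2 : P i i ^ 2 ≤ P i i := by
      conv_rhs => rw [h1]
      exact Finset.single_le_sum (f := fun j => P i j ^ 2) (fun j _ => sq_nonneg _)
        (Finset.mem_univ i)
    have h3 : P i i ≠ 0 := by
      intro h0
      rw [h0] at h1
      have h4 := (Finset.sum_eq_zero_iff_of_nonneg (fun j _ => sq_nonneg (P i j))).1 h1.symm
      obtain ⟨v, hv⟩ := hcol i
      apply hv
      rw [← hMP, Matrix.mul_apply]
      refine Finset.sum_eq_zero fun j hj => ?_
      have : P j i = P i j := by conv_lhs => rw [← hPs, Matrix.transpose_apply]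
      rw [this, pow_eq_zero_iff (two_ne_zero) |>.1 (h4 j hj), mul_zero]
    have h5 : 0 ≤ P i i := le_trans (sq_nonneg _) h2
    have h6 : 0 < P i i := lt_of_le_of_ne h5 h3.symm
    nlinarith
  have : P.trace = Fintype.card E := by simp [Matrix.trace, hdiag]
  rw [htr] at this
  exact_mod_cast this.symm

lemma forward (G : SimpleGraph V) [Fintype G.edgeSet]
    (h : (inc G * (inc G)ᵀ).det = 4) :
    G.Connected ∧ G.edgeFinset.card = Fintype.card V ∧ ¬ G.Colorable 2 := by
  classical
  have hne : Nonempty V := by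
    by_contra hV
    rw [not_nonempty_iff] at hV
    rw [det_isEmpty] at h
    norm_num at h
  obtain ⟨r⟩ := id hne
  have hR : (red G r * (red G r)ᵀ).det = 1 := by
    have := det_inc G r
    omega
  refine ⟨?_, ?_, ?_⟩
  · rw [connected_iff_exists_forall_reachable]
    refine ⟨r, ?_⟩
    by_contra! hc
    obtain ⟨w, hw⟩ := hc
    let f : V → ℤ := fun x => if G.Reachable r x then 0 else 1
    have hfr : f r = 0 := by simp [f]
    have hev : ∀ e, ∃ z, (f ᵥ* red G r) e = 2 * z := by
      rintro ⟨e, he⟩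
      induction e using Sym2.ind with
      | _ u v =>
        rw [vecMul_red, hfr]
        have : f u = f v := by
          have : G.Reachable r u ↔ G.Reachable r v :=
            ⟨fun h => h.trans (Adj.reachable he), fun h => h.trans (Adj.reachable he).symm⟩
          simp [f, this]
        exact ⟨f v, by rw [this]; ring⟩
    choose z hz using hev
    have hz' : f ᵥ* red G r = (2 : ℤ) • z := by
      ext e; simp [hz]
    have hu : IsUnit (red G r * (red G r)ᵀ).det := by rw [hR]; exact isUnit_one
    have : f = (2 : ℤ) • (z ᵥ* ((red G r)ᵀ * (red G r * (red G r)ᵀ)⁻¹)) := by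
      rw [← Matrix.smul_vecMul, ← hz', Matrix.vecMul_vecMul, ← Matrix.mul_assoc,
        Matrix.mul_nonsing_inv _ hu, Matrix.vecMul_one]
    have h1 := congrFun this w
    have hfw : f w = 1 := by simp [f, hw]
    rw [hfw, Pi.smul_apply, smul_eq_mul] at h1
    omega
  · rw [← card_eq_of_gram (red G r) hR, edgeFinset_card]
    rintro ⟨e, he⟩
    by_contra! h0
    induction e using Sym2.ind with
    | _ u v =>
      have := vecMul_red G r (fun _ => 1) u v he
      simp [vecMul, dotProduct, h0] at this
  · rintro ⟨c⟩
    let f : V → ℤ := fun x => if c x = 0 then 1 else -1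
    have hf : f ᵥ* inc G = 0 := by
      ext ⟨e, he⟩
      induction e using Sym2.ind with
      | _ u v =>
        rw [vecMul_inc]
        have hcuv : c u ≠ c v := c.valid he
        simp only [f, Pi.zero_apply]
        by_cases h1 : c u = 0 <;> by_cases h2 : c v = 0
        · exact absurd (h1.trans h2.symm) hcuv
        · simp [h1, h2]
        · simp [h1, h2]
        · omega
    have : (inc G * (inc G)ᵀ).det = 0 := by
      rw [← exists_vecMul_eq_zero_iff]
      refine ⟨f, ?_, ?_⟩
      · intro h0
        have := congrFun h0 r
        simp only [f, Pi.zero_apply] at this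
        split_ifs at this <;> omega
      · rw [← Matrix.vecMul_vecMul, hf, Matrix.zero_vecMul]
    omega

lemma walk_mem (G : SimpleGraph V) [Fintype G.edgeSet] {u v : V} (p : G.Walk u v) :
    ∃ z : G.edgeSet → ℤ, inc G *ᵥ z = Pi.single u 1 - (-1) ^ p.length • Pi.single v 1 := by
  classical
  induction p with
  | nil => exact ⟨0, by simp⟩
  | @cons a b c hab q ih =>
    obtain ⟨z, hz⟩ := ih
    refine ⟨Pi.single ⟨s(a, b), hab⟩ 1 - z, ?_⟩
    rw [Matrix.mulVec_sub, hz]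
    have hne := hab.ne
    have : inc G *ᵥ Pi.single (⟨s(a, b), hab⟩ : G.edgeSet) 1 = Pi.single a 1 + Pi.single b 1 := by
      ext x
      simp only [Matrix.mulVec_single_one, Matrix.col_apply, inc, Matrix.of_apply, Sym2.mem_iff,
        Pi.add_apply, Pi.single_apply]
      by_cases h1 : x = a <;> by_cases h2 : x = b <;> simp_all
    rw [this, Walk.length_cons, pow_succ]
    ext x
    simp
    ring

lemma exists_odd (G : SimpleGraph V) (hc : G.Connected) (h2 : ¬ G.Colorable 2) (r v : V) :
    ∃ p : G.Walk v r, Odd p.length := by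
  rw [two_colorable_iff_forall_loop_even] at h2
  push Not at h2
  obtain ⟨u, w, hw⟩ := h2
  obtain ⟨p⟩ := hc v u
  obtain ⟨q⟩ := hc u r
  by_cases ho : Odd (p.append q).length
  · exact ⟨_, ho⟩
  · refine ⟨(p.append w).append q, ?_⟩
    simp only [Walk.length_append] at ho ⊢
    grind

lemma backward (G : SimpleGraph V) [Fintype G.edgeSet] (hc : G.Connected)
    (he : G.edgeFinset.card = Fintype.card V) (h2 : ¬ G.Colorable 2) :
    (inc G * (inc G)ᵀ).det = 4 := by
  classical
  obtain ⟨r⟩ := hc.nonempty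
  rw [edgeFinset_card] at he
  let φ : V ≃ G.edgeSet := (Fintype.equivOfCardEq he).symm
  let N : Matrix V V ℤ := (inc G).submatrix id φ
  have hN : N * Nᵀ = inc G * (inc G)ᵀ := by
    simp only [N, Matrix.transpose_submatrix]
    rw [Matrix.submatrix_mul_equiv]
    simp
  have h1 : (2 : ℤ) ∣ N.det := by
    have : N = bas r * (red G r).submatrix id φ := by
      simp only [N]
      rw [← bas_mul_red G r]
      rfl
    rw [this, det_mul, det_bas]
    exact dvd_mul_right _ _
  have h3 : N.det ∣ 2 := by
    have : ∀ v, ∃ z : G.edgeSet → ℤ, inc G *ᵥ z = Pi.single v 1 + Pi.single r 1 := by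
      intro v
      obtain ⟨p, hp⟩ := exists_odd G hc h2 r v
      obtain ⟨z, hz⟩ := walk_mem G p
      refine ⟨z, ?_⟩
      rw [hz, hp.neg_one_pow]
      simp
    choose z hz using this
    have hB : bas r = N * Matrix.of (fun i v => z v (φ i)) := by
      ext i v
      have := congrFun (hz v) i
      rw [bas_apply, Matrix.mul_apply]
      simp only [Matrix.mulVec, dotProduct, Pi.add_apply, Pi.single_apply] at this
      rw [← this, ← φ.sum_comp]
      rfl
    rw [← det_bas r, hB, det_mul]
    exact dvd_mul_right _ _
  rw [← hN, det_mul, det_transpose]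
  have h4 : N.det.natAbs = 2 := by
    apply Nat.dvd_antisymm
    · exact Int.natAbs_dvd_natAbs.2 h3
    · exact Int.natAbs_dvd_natAbs.2 h1
  rcases Int.natAbs_eq N.det with h | h <;> rw [h, h4] <;> norm_num

end OddUni

theorem stmt_5 {V : Type*} [Fintype V] [DecidableEq V] (G : SimpleGraph V)
    [DecidableRel G.Adj] [Fintype G.edgeSet] :
    (signlessLaplacian G).det = 4 ↔
      (G.Connected ∧ G.edgeFinset.card = Fintype.card V ∧ ¬ G.Colorable 2) := by
  rw [OddUni.det_signless]
  constructor
  · intro h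
    exact OddUni.forward G (by exact_mod_cast h)
  · rintro ⟨h1, h2, h3⟩
    rw [OddUni.backward G h1 h2 h3]
    norm_num
end

section
/- For a connected graph G on n ≥ 3 vertices, the second largest Laplacian eigenvalue μ₂(G) is at least the second largest vertex degree d₂(G). -/
open Matrix SimpleGraph Polynomial

lemma aux_courant {V : Type*} [Fintype V] [DecidableEq V] (A : Matrix V V ℝ)
    (hA : A.IsHermitian) (f g : V → ℝ) (c m : ℝ) (i0 : V)
    (hm : ∀ i, i ≠ i0 → hA.eigenvalues i ≤ m)
    (hind : ∀ a b : ℝ, a • f + b • g = 0 → a = 0 ∧ b = 0)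
    (h : ∀ a b : ℝ, c * ((a • f + b • g) ⬝ᵥ (a • f + b • g)) ≤
      (a • f + b • g) ⬝ᵥ (A *ᵥ (a • f + b • g))) : c ≤ m := by
  set e := hA.eigenvectorBasis with he
  have hpars : ∀ x y : V → ℝ, ∑ i, (x ⬝ᵥ ⇑(e i)) * (y ⬝ᵥ ⇑(e i)) = x ⬝ᵥ y := by
    intro x y
    have := e.sum_inner_mul_inner (WithLp.toLp 2 x) (WithLp.toLp 2 y)
    simp only [EuclideanSpace.inner_eq_star_dotProduct, star_trivial] at this
    rw [dotProduct_comm x y, ← this]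
    refine Finset.sum_congr rfl fun i _ => ?_
    rw [dotProduct_comm x]
  have hAe : ∀ (x : V → ℝ) i, (A *ᵥ x) ⬝ᵥ ⇑(e i) = hA.eigenvalues i * (x ⬝ᵥ ⇑(e i)) := by
    intro x i
    have hT : Aᵀ = A := by simpa using hA.eq
    have h1 : (A *ᵥ x) = x ᵥ* A := by
      conv_rhs => rw [← hT]
      rw [vecMul_transpose]
    rw [h1, ← dotProduct_mulVec, hA.mulVec_eigenvectorBasis, dotProduct_smul, smul_eq_mul]
  obtain ⟨a, b, hab, h0⟩ : ∃ a b : ℝ, ¬ (a = 0 ∧ b = 0) ∧ (a • f + b • g) ⬝ᵥ ⇑(e i0) = 0 := by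
    by_cases hf : f ⬝ᵥ ⇑(e i0) = 0
    · exact ⟨1, 0, by simp, by simpa using hf⟩
    · refine ⟨- (g ⬝ᵥ ⇑(e i0)), f ⬝ᵥ ⇑(e i0), by tauto, ?_⟩
      rw [add_dotProduct, smul_dotProduct, smul_dotProduct, smul_eq_mul, smul_eq_mul]
      ring
  have hx0 : a • f + b • g ≠ 0 := fun hx => hab (hind a b hx)
  have hh := h a b
  generalize a • f + b • g = x at *
  have hpos : 0 < x ⬝ᵥ x := by
    have h1 : 0 ≤ x ⬝ᵥ x := Finset.sum_nonneg fun i _ => mul_self_nonneg _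
    exact lt_of_le_of_ne h1 (fun hh => hx0 (dotProduct_self_eq_zero.1 hh.symm))
  have hle : x ⬝ᵥ (A *ᵥ x) ≤ m * (x ⬝ᵥ x) := by
    rw [← hpars x (A *ᵥ x), ← hpars x x, Finset.mul_sum]
    refine Finset.sum_le_sum fun i _ => ?_
    rw [hAe]
    by_cases hi : i = i0
    · subst hi; simp [h0]
    · nlinarith [mul_le_mul_of_nonneg_right (hm i hi) (mul_self_nonneg (x ⬝ᵥ ⇑(e i)))]
  exact le_of_mul_le_mul_right (hh.trans hle) hpos

lemma aux_eigs {V : Type*} [Fintype V] [DecidableEq V] (A : Matrix V V ℝ)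
    (hA : A.IsHermitian) (hn : 2 ≤ Fintype.card V) :
    ∃ i0, ∀ i, i ≠ i0 → hA.eigenvalues i ≤ (eigsDesc A).getD 1 0 := by
  have hl : eigsDesc A = List.ofFn hA.eigenvalues₀ := by
    unfold eigsDesc
    have hs : ((A.charpoly.roots.sort (· ≤ ·)).reverse).Perm (List.ofFn hA.eigenvalues₀) := by
      rw [← Multiset.coe_eq_coe, Multiset.coe_reverse, Multiset.sort_eq,
        hA.roots_charpoly_eq_eigenvalues₀, Fin.univ_val_map]
      rfl
    refine hs.eq_of_pairwise (le := (· ≥ ·)) (fun a b _ _ h1 h2 => le_antisymm h2 h1) ?_ ?_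
    · rw [List.pairwise_reverse]
      exact Multiset.pairwise_sort _ _
    · rw [← List.sortedGE_iff_pairwise]
      exact (hA.eigenvalues₀_antitone).sortedGE_ofFn
  refine ⟨(Fintype.equivOfCardEq (Fintype.card_fin _)) (⟨0, by omega⟩ : Fin (Fintype.card V)), fun i hi => ?_⟩
  have h1 : (eigsDesc A).getD 1 0 = hA.eigenvalues₀ ⟨1, by omega⟩ := by
    rw [hl, List.getD_eq_getElem _ _ (by rw [List.length_ofFn]; omega)]
    simp
  rw [h1]
  unfold Matrix.IsHermitian.eigenvalues
  apply hA.eigenvalues₀_antitone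
  rw [Fin.le_def]
  by_contra hc
  apply hi
  rw [← Equiv.symm_apply_eq]
  ext
  simp at hc ⊢
  omega

lemma aux_degs {V : Type*} [Fintype V] [DecidableEq V] (G : SimpleGraph V)
    [DecidableRel G.Adj] (hn : 2 ≤ Fintype.card V) :
    ∃ u v, u ≠ v ∧ G.degree v ≤ G.degree u ∧ G.degree v = (degsDesc G).getD 1 0 := by
  have hperm : ((degsDesc G : List ℕ) : Multiset ℕ) = Finset.univ.val.map fun v => G.degree v := by
    unfold degsDesc
    rw [Multiset.coe_reverse, Multiset.sort_eq]
  have hpw : (degsDesc G).Pairwise (· ≥ ·) := by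
    unfold degsDesc
    rw [List.pairwise_reverse]
    exact Multiset.pairwise_sort _ _
  have hlen : (degsDesc G).length = Fintype.card V := by
    rw [← Multiset.coe_card, hperm, Multiset.card_map]; rfl
  generalize degsDesc G = l at *
  match l, hperm, hpw, hlen with
  | [], _, _, hlen => simp at hlen; omega
  | [_], _, _, hlen => simp at hlen; omega
  | a :: b :: t, hperm, hpw, hlen =>
    rw [← Multiset.cons_coe] at hperm
    obtain ⟨u, -, hu, hu'⟩ := (Multiset.map_eq_cons _ _ _ _).2 hperm.symm
    have hb : b ∈ (Finset.univ.val.erase u).map fun v => G.degree v := by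
      rw [hu']; simp
    obtain ⟨v, hv, hvb⟩ := Multiset.mem_map.1 hb
    refine ⟨u, v, ?_, ?_, by simpa using hvb⟩
    · rintro rfl
      exact (Multiset.Nodup.notMem_erase Finset.univ.nodup) hv
    · rw [hu, hvb]
      exact (List.pairwise_cons.1 hpw).1 b (by simp)

lemma aux_split {V : Type*} [Fintype V] [DecidableEq V] {u v : V} (huv : u ≠ v) (F : V → ℝ) :
    ∑ i, F i = F u + F v + ∑ w ∈ (Finset.univ.erase u).erase v, F w := by
  rw [← Finset.add_sum_erase _ F (Finset.mem_univ u),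
    ← Finset.add_sum_erase (Finset.univ.erase u) F (a := v) (by simp [huv.symm])]
  ring

lemma aux_form {V : Type*} [Fintype V] [DecidableEq V] (G : SimpleGraph V)
    [DecidableRel G.Adj] {u v : V} (huv : u ≠ v) (x : V → ℝ) :
    (if G.Adj u v then (x u - x v) ^ 2 else 0) +
      ∑ w ∈ (Finset.univ.erase u).erase v, ((if G.Adj u w then (x u - x w) ^ 2 else 0) +
        (if G.Adj v w then (x v - x w) ^ 2 else 0)) ≤ x ⬝ᵥ (G.lapMatrix ℝ *ᵥ x) := by
  rw [← toLinearMap₂'_apply', lapMatrix_toLinearMap₂']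
  set f : V → V → ℝ := fun i j => if G.Adj i j then (x i - x j) ^ 2 else 0 with hf
  have hsymm : ∀ i j, f i j = f j i := by
    intro i j
    simp only [hf, G.adj_comm i j]
    congr 1
    ring
  have hnn : ∀ i j, 0 ≤ f i j := by
    intro i j
    simp only [hf]
    split_ifs <;> positivity
  have hd : ∀ i, f i i = 0 := by intro i; simp [hf]
  change f u v + ∑ w ∈ (Finset.univ.erase u).erase v, (f u w + f v w) ≤ (∑ i, ∑ j, f i j) / 2
  rw [aux_split huv (fun i => ∑ j, f i j), aux_split huv (f u), aux_split huv (f v), hd, hd,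
    hsymm v u]
  have : ∑ w ∈ (Finset.univ.erase u).erase v, (f u w + f v w) ≤
      ∑ w ∈ (Finset.univ.erase u).erase v, ∑ j, f w j := by
    refine Finset.sum_le_sum fun w _ => ?_
    rw [aux_split huv (f w), hsymm u w, hsymm v w]
    have := Finset.sum_nonneg fun j (_ : j ∈ (Finset.univ.erase u).erase v) => hnn w j
    linarith
  have h2 := Finset.sum_add_distrib (s := (Finset.univ.erase u).erase v) (f := f u) (g := f v)
  linarith

/-- The key step: a two-parameter family of test vectors. -/
lemma aux_test {V : Type*} [Fintype V] [DecidableEq V] (G : SimpleGraph V)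
    [DecidableRel G.Adj] (hn : 2 ≤ Fintype.card V) {u v : V} (huv : u ≠ v) (c s : ℝ)
    (h : ∀ a b : ℝ, c * (a ^ 2 + b ^ 2) ≤ (if G.Adj u v then (a - b) ^ 2 else 0) +
      ∑ w ∈ (Finset.univ.erase u).erase v,
        ((if G.Adj u w then (a + s * (a * (if G.Adj u w then 1 else 0)
            + b * (if G.Adj v w then 1 else 0))) ^ 2 else 0) +
        (if G.Adj v w then (b + s * (a * (if G.Adj u w then 1 else 0)
            + b * (if G.Adj v w then 1 else 0))) ^ 2 else 0) -
          c * (s * (a * (if G.Adj u w then 1 else 0)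
            + b * (if G.Adj v w then 1 else 0))) ^ 2)) :
    c ≤ (eigsDesc (G.lapMatrix ℝ)).getD 1 0 := by
  have hA : (G.lapMatrix ℝ).IsHermitian := G.isHermitian_lapMatrix ℝ
  obtain ⟨i0, hi0⟩ := aux_eigs _ hA hn
  let f : V → ℝ := fun w => if w = u then 1 else if w = v then 0 else
    -(s * (if G.Adj u w then 1 else 0))
  let g : V → ℝ := fun w => if w = u then 0 else if w = v then 1 else
    -(s * (if G.Adj v w then 1 else 0))
  have hu : ∀ a b : ℝ, (a • f + b • g) u = a := by intro a b; simp [f, g]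
  have hv : ∀ a b : ℝ, (a • f + b • g) v = b := by intro a b; simp [f, g, huv.symm]
  have hw : ∀ a b : ℝ, ∀ w ∈ (Finset.univ.erase u).erase v, (a • f + b • g) w =
      - (s * (a * (if G.Adj u w then 1 else 0) + b * (if G.Adj v w then 1 else 0))) := by
    intro a b w hw
    simp only [Finset.mem_erase, Finset.mem_univ, and_true] at hw
    simp only [f, g, Pi.add_apply, Pi.smul_apply, smul_eq_mul, if_neg hw.1, if_neg hw.2]
    ring
  refine aux_courant _ hA f g c _ i0 hi0 ?_ ?_
  · intro a b hab
    have h1 := hu a b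
    have h2 := hv a b
    rw [hab] at h1 h2
    exact ⟨h1.symm, h2.symm⟩
  · intro a b
    refine le_trans ?_ (aux_form G huv _)
    have h3 := h a b
    rw [dotProduct, aux_split huv, hu, hv]
    rw [Finset.sum_sub_distrib, ← Finset.mul_sum] at h3
    have e1 : ∑ w ∈ (Finset.univ.erase u).erase v, (a • f + b • g) w * (a • f + b • g) w =
      ∑ w ∈ (Finset.univ.erase u).erase v, (s * (a * (if G.Adj u w then 1 else 0)
            + b * (if G.Adj v w then 1 else 0))) ^ 2 := by
      refine Finset.sum_congr rfl fun w hw' => ?_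
      rw [hw a b w hw']; ring
    rw [e1]
    have e2 : ∀ w ∈ (Finset.univ.erase u).erase v,
      ((if G.Adj u w then (a - (a • f + b • g) w) ^ 2 else 0) +
        (if G.Adj v w then (b - (a • f + b • g) w) ^ 2 else 0)) =
        ((if G.Adj u w then (a + s * (a * (if G.Adj u w then 1 else 0)
            + b * (if G.Adj v w then 1 else 0))) ^ 2 else 0) +
        (if G.Adj v w then (b + s * (a * (if G.Adj u w then 1 else 0)
            + b * (if G.Adj v w then 1 else 0))) ^ 2 else 0)) := by
      intro w hw'
      rw [hw a b w hw', sub_neg_eq_add, sub_neg_eq_add]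
    rw [Finset.sum_congr rfl e2]
    linarith

lemma aux_deg {V : Type*} [Fintype V] [DecidableEq V] (G : SimpleGraph V)
    [DecidableRel G.Adj] {u v : V} (huv : u ≠ v) :
    (G.degree u : ℝ) = (if G.Adj u v then 1 else 0) +
      ∑ w ∈ (Finset.univ.erase u).erase v, (if G.Adj u w then 1 else 0) ∧
    (G.degree v : ℝ) = (if G.Adj u v then 1 else 0) +
      ∑ w ∈ (Finset.univ.erase u).erase v, (if G.Adj v w then 1 else 0) := by
  constructor
  · rw [degree_eq_sum_if_adj, aux_split huv]; simp
  · rw [degree_eq_sum_if_adj, aux_split huv]; simp [G.adj_comm]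

lemma aux_nonadj {V : Type*} [Fintype V] [DecidableEq V] (G : SimpleGraph V)
    [DecidableRel G.Adj] (hn : 2 ≤ Fintype.card V) {u v : V} (huv : u ≠ v)
    (hadj : ¬ G.Adj u v) (c : ℝ) (h1 : c ≤ G.degree u) (h2 : c ≤ G.degree v) :
    c ≤ (eigsDesc (G.lapMatrix ℝ)).getD 1 0 := by
  refine aux_test G hn huv c 0 fun a b => ?_
  obtain ⟨hu, hv⟩ := aux_deg G huv
  rw [if_neg hadj, zero_add] at hu hv
  rw [if_neg hadj, zero_add]
  have : ∀ w, ((if G.Adj u w then (a + 0 * (a * (if G.Adj u w then 1 else 0)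
            + b * (if G.Adj v w then 1 else 0))) ^ 2 else 0) +
        (if G.Adj v w then (b + 0 * (a * (if G.Adj u w then 1 else 0)
            + b * (if G.Adj v w then 1 else 0))) ^ 2 else 0) -
          c * (0 * (a * (if G.Adj u w then 1 else 0)
            + b * (if G.Adj v w then 1 else 0))) ^ 2) =
      (a ^ 2 * (if G.Adj u w then 1 else 0) + b ^ 2 * (if G.Adj v w then 1 else 0)) := by
    intro w
    split_ifs <;> ring
  rw [Finset.sum_congr rfl fun w _ => this w, Finset.sum_add_distrib, ← Finset.mul_sum,
    ← Finset.mul_sum, ← hu, ← hv]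
  nlinarith [mul_le_mul_of_nonneg_left h1 (sq_nonneg a), mul_le_mul_of_nonneg_left h2 (sq_nonneg b)]

lemma aux_adj {V : Type*} [Fintype V] [DecidableEq V] (G : SimpleGraph V)
    [DecidableRel G.Adj] (hn : 2 ≤ Fintype.card V) {u v : V} (huv : u ≠ v)
    (hadj : G.Adj u v) (h1 : G.degree v ≤ G.degree u) (h2 : 2 ≤ G.degree v) :
    (G.degree v : ℝ) ≤ (eigsDesc (G.lapMatrix ℝ)).getD 1 0 := by
  have h1' : (G.degree v : ℝ) ≤ G.degree u := by exact_mod_cast h1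
  have h2' : (2 : ℝ) ≤ G.degree v := by exact_mod_cast h2
  obtain ⟨hu, hv⟩ := aux_deg G huv
  rw [if_pos hadj] at hu hv
  generalize (G.degree v : ℝ) = d at *
  generalize (G.degree u : ℝ) = D at *
  obtain ⟨s, hs⟩ : ∃ s : ℝ, s = 1 / (d - 1) := ⟨_, rfl⟩
  have hs0 : 0 ≤ s := by rw [hs]; apply div_nonneg <;> linarith
  have hs1 : (d - 1) * s = 1 := by
    rw [hs]; field_simp [show d - 1 ≠ 0 by linarith]
  refine aux_test G hn huv d s fun a b => ?_
  rw [if_pos hadj]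
  have hds : d * s = 1 + s := by linarith
  have key : ∀ w ∈ (Finset.univ.erase u).erase v,
      ((1 + s) * a ^ 2) * (if G.Adj u w then 1 else 0) +
        (b ^ 2 + s * (2 * a * b - a ^ 2)) * (if G.Adj v w then 1 else 0) ≤
      ((if G.Adj u w then (a + s * (a * (if G.Adj u w then 1 else 0)
            + b * (if G.Adj v w then 1 else 0))) ^ 2 else 0) +
        (if G.Adj v w then (b + s * (a * (if G.Adj u w then 1 else 0)
            + b * (if G.Adj v w then 1 else 0))) ^ 2 else 0) -
          d * (s * (a * (if G.Adj u w then 1 else 0)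
            + b * (if G.Adj v w then 1 else 0))) ^ 2) := by
    intro w _
    have e : ∀ t : ℝ, d * (s * t) ^ 2 = (1 + s) * s * t ^ 2 := by
      intro t; rw [← hds]; ring
    rw [e]
    split_ifs
    · nlinarith [mul_nonneg hs0 (sq_nonneg (a + b)), mul_nonneg hs0 (sq_nonneg a),
        mul_nonneg hs0 (sq_nonneg b), mul_nonneg (mul_nonneg hs0 hs0) (sq_nonneg (a + b))]
    · nlinarith
    · nlinarith [mul_nonneg hs0 (sq_nonneg (a - b))]
    · nlinarith
  have hsum := Finset.sum_le_sum key
  rw [Finset.sum_add_distrib, ← Finset.mul_sum, ← Finset.mul_sum] at hsum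
  rw [show ∑ w ∈ (Finset.univ.erase u).erase v, (if G.Adj u w then (1 : ℝ) else 0) = D - 1 by
    linarith, show ∑ w ∈ (Finset.univ.erase u).erase v, (if G.Adj v w then (1 : ℝ) else 0) = d - 1 by
    linarith] at hsum
  have h3 : (1 + s) * a ^ 2 * (d - 1) ≤ (1 + s) * a ^ 2 * (D - 1) :=
    mul_le_mul_of_nonneg_left (by linarith) (by positivity)
  have h4 : (1 + s) * a ^ 2 * (d - 1) + (b ^ 2 + s * (2 * a * b - a ^ 2)) * (d - 1) =
      (d - 1) * (a ^ 2 + b ^ 2) + ((d - 1) * s) * (2 * a * b) := by ring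
  rw [hs1] at h4
  linarith

theorem stmt_6 {V : Type*} [Fintype V] [DecidableEq V] (G : SimpleGraph V)
    [DecidableRel G.Adj] (hG : G.Connected) (hn : 3 ≤ Fintype.card V) :
    ((degsDesc G).getD 1 0 : ℝ) ≤ (eigsDesc (G.lapMatrix ℝ)).getD 1 0 := by
  obtain ⟨u, v, huv, hle, hd⟩ := aux_degs G (by omega)
  rw [← hd]
  by_cases hadj : G.Adj u v
  · by_cases h2 : 2 ≤ G.degree v
    · exact aux_adj G (by omega) huv hadj hle h2
    · have hpos : 0 < G.degree v := (G.degree_pos_iff_exists_adj v).2 ⟨u, hadj.symm⟩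
      have hone : G.degree v = 1 := by omega
      obtain ⟨w, hwv, hwu⟩ : ∃ w, w ≠ v ∧ w ≠ u := by
        by_contra hc
        push Not at hc
        have : (Finset.univ : Finset V) ⊆ {u, v} := by
          intro w _
          by_cases h : w = v
          · simp [h]
          · simp [hc w h]
        have := (Finset.card_le_card this).trans Finset.card_le_two
        rw [Finset.card_univ] at this
        omega
      have : Nontrivial V := ⟨u, v, huv⟩
      have hw : 0 < G.degree w := hG.preconnected.degree_pos_of_nontrivial w
      refine aux_nonadj G (by omega) hwv ?_ _ (by rw [hone]; exact_mod_cast hw) le_rfl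
      intro hwv'
      obtain ⟨z, hz⟩ := Finset.card_eq_one.1 ((G.card_neighborFinset_eq_degree v).trans hone)
      have a1 : u ∈ G.neighborFinset v := by simpa using hadj.symm
      have a2 : w ∈ G.neighborFinset v := by simpa using hwv'.symm
      rw [hz, Finset.mem_singleton] at a1 a2
      exact hwu (a2.trans a1.symm)
  · exact aux_nonadj G (by omega) huv hadj _ (by exact_mod_cast hle) le_rfl
end

section
/- For a tree T of order n, the largest Laplacian eigenvalue μ₁(T) equals n if and only if T is the star S_n. -/
open Matrix SimpleGraph Polynomial

lemma lap_apply' {V : Type*} [Fintype V] [DecidableEq V] (G : SimpleGraph V)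
    [DecidableRel G.Adj] (x : V → ℝ) (v : V) :
    (G.lapMatrix ℝ *ᵥ x) v = ∑ u, if G.Adj v u then x v - x u else 0 := by
  rw [lapMatrix_mulVec_apply, degree_eq_sum_if_adj, ← Finset.sum_filter,
    ← Finset.sum_filter, Finset.sum_sub_distrib, neighborFinset_eq_filter]
  simp

lemma lap_compl {V : Type*} [Fintype V] [DecidableEq V] (G : SimpleGraph V)
    [DecidableRel G.Adj] (x : V → ℝ) (v : V) :
    (G.lapMatrix ℝ *ᵥ x) v + (Gᶜ.lapMatrix ℝ *ᵥ x) v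
      = (Fintype.card V : ℝ) * x v - ∑ u, x u := by
  rw [lap_apply', lap_apply', ← Finset.sum_add_distrib]
  have : ∀ u, ((if G.Adj v u then x v - x u else 0) + if Gᶜ.Adj v u then x v - x u else 0)
      = x v - x u := by
    intro u
    by_cases h : v = u
    · subst h; simp
    · by_cases h' : G.Adj v u <;> simp [h, h']
  rw [Finset.sum_congr rfl (fun u _ => this u), Finset.sum_sub_distrib]
  simp

lemma lap_sum {V : Type*} [Fintype V] [DecidableEq V] (G : SimpleGraph V)
    [DecidableRel G.Adj] (x : V → ℝ) : ∑ v, (G.lapMatrix ℝ *ᵥ x) v = 0 := by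
  have h : ∑ v, (G.lapMatrix ℝ *ᵥ x) v = - ∑ v, (G.lapMatrix ℝ *ᵥ x) v := by
    conv_lhs => simp only [lap_apply']
    rw [Finset.sum_comm, ← Finset.sum_neg_distrib]
    refine Finset.sum_congr rfl fun v _ => ?_
    rw [lap_apply', ← Finset.sum_neg_distrib]
    refine Finset.sum_congr rfl fun u _ => ?_
    by_cases h : G.Adj u v
    · simp [h, h.symm]
    · have h2 : ¬ G.Adj v u := fun h' => h h'.symm
      simp [h, h2]
  linarith

lemma mem_eigs_iff {V : Type*} [Fintype V] [DecidableEq V] (M : Matrix V V ℝ) (r : ℝ) :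
    r ∈ eigsDesc M ↔ ∃ x : V → ℝ, x ≠ 0 ∧ M *ᵥ x = r • x := by
  unfold eigsDesc
  rw [List.mem_reverse, Multiset.mem_sort, Polynomial.mem_roots (M.charpoly_monic.ne_zero),
    Polynomial.IsRoot.def, Matrix.eval_charpoly, ← Matrix.exists_mulVec_eq_zero_iff]
  refine exists_congr fun x => and_congr Iff.rfl ?_
  rw [Matrix.sub_mulVec, sub_eq_zero]
  have : (Matrix.scalar V r) *ᵥ x = r • x := by
    ext i; simp [Matrix.scalar_apply, Matrix.mulVec_diagonal]
  rw [this, eq_comm]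

lemma eigs_compl {V : Type*} [Fintype V] [DecidableEq V] (G : SimpleGraph V)
    [DecidableRel G.Adj] (x : V → ℝ) (r : ℝ) (hr : r ≠ 0) (h : G.lapMatrix ℝ *ᵥ x = r • x) :
    ∑ u, x u = 0 ∧ Gᶜ.lapMatrix ℝ *ᵥ x = ((Fintype.card V : ℝ) - r) • x := by
  have hs : ∑ u, x u = 0 := by
    have := lap_sum G x
    rw [h] at this
    simp only [Pi.smul_apply, smul_eq_mul, ← Finset.mul_sum] at this
    exact (mul_eq_zero.mp this).resolve_left hr
  refine ⟨hs, ?_⟩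
  ext v
  have := lap_compl G x v
  rw [h, hs] at this
  simp only [Pi.smul_apply, smul_eq_mul] at this ⊢
  linarith

lemma eigs_le {V : Type*} [Fintype V] [DecidableEq V] (G : SimpleGraph V)
    [DecidableRel G.Adj] (r : ℝ) (h : r ∈ eigsDesc (G.lapMatrix ℝ)) :
    r ≤ Fintype.card V := by
  obtain ⟨x, hx, h⟩ := (mem_eigs_iff _ _).1 h
  by_cases hr : r = 0
  · rw [hr]; positivity
  obtain ⟨-, h2⟩ := eigs_compl G x r hr h
  have h3 := (posSemidef_lapMatrix ℝ Gᶜ).dotProduct_mulVec_nonneg x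
  rw [h2, star_trivial, dotProduct_smul, smul_eq_mul] at h3
  have h4 : 0 < x ⬝ᵥ x := by
    have := (Matrix.dotProduct_star_self_pos_iff (v := x)).2 hx
    simpa using this
  by_contra hc
  push Not at hc
  nlinarith

lemma universal_degree {V : Type*} [Fintype V] [DecidableEq V] (G : SimpleGraph V)
    [DecidableRel G.Adj] (v : V) : G.degree v = Fintype.card V - 1 ↔ ∀ u, u ≠ v → G.Adj v u := by
  have hsub : G.neighborFinset v ⊆ Finset.univ.erase v := by
    intro u hu
    simp only [mem_neighborFinset] at hu
    simp [hu.ne']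
  have hc : (Finset.univ.erase v).card = Fintype.card V - 1 := by
    rw [Finset.card_erase_of_mem (Finset.mem_univ _), Finset.card_univ]
  rw [← card_neighborFinset_eq_degree, ← hc]
  constructor
  · intro h u hu
    have := Finset.eq_of_subset_of_card_le hsub h.ge
    rw [← mem_neighborFinset, this]
    simp [hu]
  · intro h
    congr 1
    refine hsub.antisymm fun u hu => ?_
    simp only [Finset.mem_erase] at hu
    simpa using h u hu.1

lemma no_four_cycle {V : Type*} (G : SimpleGraph V) (hG : G.IsAcyclic) {a a' b b' : V}
    (ha : a ≠ a') (hb : b ≠ b') (h1 : G.Adj a b) (h2 : G.Adj b a') (h3 : G.Adj a b')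
    (h4 : G.Adj b' a') : False := by
  have hp : (Walk.cons h1 (Walk.cons h2 Walk.nil)).IsPath := by
    simp [Walk.cons_isPath_iff, ha, h1.ne, h2.ne]
  have hq : (Walk.cons h3 (Walk.cons h4 Walk.nil)).IsPath := by
    simp [Walk.cons_isPath_iff, ha, h3.ne, h4.ne]
  have := congrArg (fun p => p.1.support) (hG.path_unique ⟨_, hp⟩ ⟨_, hq⟩)
  simp at this
  exact hb this

theorem stmt_8 {V : Type*} [Fintype V] [DecidableEq V] (T : SimpleGraph V)
    [DecidableRel T.Adj] (hT : T.IsTree) (hn : 2 ≤ Fintype.card V) :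
    (eigsDesc (T.lapMatrix ℝ)).getD 0 0 = (Fintype.card V : ℝ) ↔
      ∃ v : V, T.degree v = Fintype.card V - 1 := by
  have hn0 : (Fintype.card V : ℝ) ≠ 0 := by
    have : Fintype.card V ≠ 0 := by omega
    exact_mod_cast this
  constructor
  · intro h
    have hmem : (Fintype.card V : ℝ) ∈ eigsDesc (T.lapMatrix ℝ) := by
      rcases hl : eigsDesc (T.lapMatrix ℝ) with _ | ⟨c, l⟩
      · rw [hl] at h
        exact absurd h.symm (by simpa using hn0)
      · rw [hl] at h
        simp at h
        simp [h]
    obtain ⟨x, hx, hx2⟩ := (mem_eigs_iff _ _).1 hmem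
    obtain ⟨hs, hc⟩ := eigs_compl T x _ hn0 hx2
    rw [sub_self, zero_smul, lapMatrix_mulVec_eq_zero_iff_forall_adj] at hc
    have key : ∀ u w, x u ≠ x w → T.Adj u w := by
      intro u w huw
      by_contra hna
      exact huw (hc u w ((compl_adj _ _ _).2 ⟨fun e => huw (by rw [e]), hna⟩))
    obtain ⟨a, b, hab⟩ : ∃ a b, x a ≠ x b := by
      by_contra! hcon
      apply hx
      ext a
      have : ∑ u, x u = Fintype.card V * x a := by
        rw [Finset.sum_congr rfl (fun u _ => hcon u a)]
        simp
      rw [hs] at this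
      exact (mul_eq_zero.mp this.symm).resolve_left hn0
    by_cases hA : ∃ a', a ≠ a' ∧ x a' = x a
    · obtain ⟨a', ha, hxa⟩ := hA
      refine ⟨b, (universal_degree T b).2 fun u hu => key _ _ fun hbu => ?_⟩
      exact no_four_cycle T hT.isAcyclic ha hu.symm (key _ _ hab)
        (key _ _ (by rw [hxa]; exact hab.symm)) (key _ _ (by rw [← hbu]; exact hab))
        (key _ _ (by rw [hxa, ← hbu]; exact hab.symm))
    · push Not at hA
      exact ⟨a, (universal_degree T a).2 fun u hu => key _ _ (hA u hu.symm).symm⟩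
  · rintro ⟨v, hv⟩
    rw [universal_degree] at hv
    have hmem : (Fintype.card V : ℝ) ∈ eigsDesc (T.lapMatrix ℝ) := by
      rw [mem_eigs_iff]
      let x : V → ℝ := fun u => if u = v then (Fintype.card V : ℝ) - 1 else -1
      have hsum : ∑ u, x u = 0 := by
        have : ∀ u, x u = (if u = v then (Fintype.card V : ℝ) else 0) - 1 := by
          intro u
          by_cases h : u = v <;> simp [x, h]
        simp [this]
      have hc : Tᶜ.lapMatrix ℝ *ᵥ x = 0 := by
        rw [lapMatrix_mulVec_eq_zero_iff_forall_adj]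
        intro i j hij
        rw [compl_adj] at hij
        have hi : i ≠ v := by
          rintro rfl
          exact hij.2 (hv j hij.1.symm)
        have hj : j ≠ v := by
          rintro rfl
          exact hij.2 (hv i hij.1).symm
        simp [x, hi, hj]
      refine ⟨x, ?_, ?_⟩
      · intro h0
        have := congrFun h0 v
        have h2 : (2 : ℝ) ≤ Fintype.card V := by exact_mod_cast hn
        simp [x] at this
        linarith
      · ext u
        have := lap_compl T x u
        rw [hc, hsum] at this
        simpa using this
    have hle := eigs_le T
    have hsorted : (eigsDesc (T.lapMatrix ℝ)).Pairwise (· ≥ ·) := by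
      unfold eigsDesc
      rw [List.pairwise_reverse]
      exact Multiset.pairwise_sort _ _
    rcases hl : eigsDesc (T.lapMatrix ℝ) with _ | ⟨c, l⟩
    · rw [hl] at hmem
      simp at hmem
    · rw [hl] at hmem hsorted
      have h1 := hle c (by rw [hl]; simp)
      rw [List.pairwise_cons] at hsorted
      simp only [List.getD_cons_zero]
      rcases List.mem_cons.1 hmem with h | h
      · exact h.symm
      · exact le_antisymm h1 (hsorted.1 _ h)
end

section
/- If T is a tree on n vertices and μ > 1 is an integer Laplacian eigenvalue of T, then μ divides n and μ has multiplicity 1 as a Laplacian eigenvalue of T. -/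
open Matrix SimpleGraph Polynomial

theorem aux_sum_antisymm {V A : Type*} [AddCommGroup A] (S : Finset V) (T : SimpleGraph V)
    [DecidableRel T.Adj] (x : V → A) :
    ∑ a ∈ S, ∑ b ∈ S, (if T.Adj a b then x a - x b else 0) = 0 := by
  have h : ∀ a b, (if T.Adj a b then x a - x b else 0) =
      (if T.Adj a b then x a else 0) - (if T.Adj a b then x b else 0) := by
    intro a b; split_ifs <;> simp
  simp_rw [h, Finset.sum_sub_distrib]
  rw [sub_eq_zero]
  conv_rhs => rw [Finset.sum_comm]
  simp_rw [T.adj_comm]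

/-- Over any abelian group, the kernel of the Laplacian of a tree consists of constants. -/
theorem aux_kernel {V A : Type*} [Fintype V] [DecidableEq V] [AddCommGroup A] (T : SimpleGraph V)
    [DecidableRel T.Adj] (hT : T.IsTree) (x : V → A)
    (hx : ∀ a, ∑ b, (if T.Adj a b then x a - x b else 0) = 0) (u v : V) : x u = x v := by
  classical
  have hadj : ∀ u v, T.Adj u v → x u = x v := by
    intro u v huv
    have hb := (isAcyclic_iff_forall_adj_isBridge.mp hT.2) huv
    rw [isBridge_iff] at hb
    set G := T \ fromEdgeSet {s(u, v)} with hG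
    replace hb : ¬ G.Reachable u v := by first | exact hb | exact hb.2
    let S : Finset V := Finset.univ.filter (fun w => G.Reachable u w)
    have huS : u ∈ S := by simp [S]
    have hvS : v ∈ Sᶜ := by simpa [S] using hb
    have key : ∀ a ∈ S, ∀ b ∈ Sᶜ, T.Adj a b → a = u ∧ b = v := by
      intro a ha b hb' hab
      simp only [S, Finset.mem_filter, Finset.mem_univ, true_and, Finset.mem_compl] at ha hb'
      by_cases he : s(a, b) = s(u, v)
      · rcases Sym2.eq_iff.mp he with h | h
        · exact h
        · exact absurd (h.1 ▸ ha) hb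
      · exfalso
        apply hb'
        refine ha.trans (Adj.reachable ?_)
        rw [hG, sdiff_adj, fromEdgeSet_adj]
        exact ⟨hab, fun h => he h.1⟩
    have h0 : ∑ a ∈ S, ∑ b, (if T.Adj a b then x a - x b else 0) = 0 :=
      Finset.sum_eq_zero fun a _ => hx a
    simp_rw [← Finset.sum_add_sum_compl S] at h0
    rw [Finset.sum_add_distrib, aux_sum_antisymm, zero_add, Finset.sum_eq_single_of_mem u huS,
      Finset.sum_eq_single_of_mem v hvS, if_pos huv] at h0
    · exact sub_eq_zero.mp h0
    · intro b hb' hne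
      exact if_neg fun h => hne (key u huS b hb' h).2
    · intro a ha hne
      exact Finset.sum_eq_zero fun b hb' => if_neg fun h => hne (key a ha b hb' h).1
  obtain ⟨p⟩ := hT.1.preconnected u v
  induction p with
  | nil => rfl
  | cons h _ ih => exact (hadj _ _ h).trans ih

theorem aux_int {V : Type*} [Fintype V] [DecidableEq V] (T : SimpleGraph V)
    [DecidableRel T.Adj] (hT : T.IsTree) (μ : ℕ) (hμ : 1 < μ) (y : V → ℤ) (hy : y ≠ 0)
    (h : ∀ a, ∑ b, (if T.Adj a b then y a - y b else 0) = μ * y a) :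
    μ ∣ Fintype.card V ∧ ∀ v, y v ≠ 0 := by
  obtain ⟨w, hw⟩ := Function.ne_iff.mp hy
  obtain ⟨x, hxg, hx1⟩ := Finset.extract_gcd y (s := Finset.univ) ⟨w, Finset.mem_univ _⟩
  set g := Finset.univ.gcd y
  have hg : g ≠ 0 := by
    intro h0
    exact hw (by rw [hxg w (Finset.mem_univ _), h0, zero_mul]; rfl)
  have hx : ∀ a, ∑ b, (if T.Adj a b then x a - x b else 0) = μ * x a := by
    intro a
    apply mul_left_cancel₀ hg
    have := h a
    rw [Finset.mul_sum]
    calc _ = ∑ b, (if T.Adj a b then y a - y b else 0) := by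
            refine Finset.sum_congr rfl fun b _ => ?_
            rw [hxg a (Finset.mem_univ _), hxg b (Finset.mem_univ _)]
            split_ifs <;> ring
      _ = _ := by rw [this, hxg a (Finset.mem_univ _)]; ring
  have hdiv : ∀ a b, (μ : ℤ) ∣ x b - x a := by
    intro a b
    rw [← ZMod.intCast_eq_intCast_iff_dvd_sub]
    refine aux_kernel T hT (fun v => ((x v : ℤ) : ZMod μ)) (fun c => ?_) a b
    have := congrArg (Int.cast : ℤ → ZMod μ) (hx c)
    push_cast at this
    simpa using this
  have hcop : ∀ a, IsCoprime (μ : ℤ) (x a) := by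
    intro a
    rw [← isRelPrime_iff_isCoprime]
    intro d hd1 hd2
    rw [isUnit_iff_dvd_one, ← hx1]
    refine Finset.dvd_gcd fun b _ => ?_
    have := (hd1.trans (hdiv a b)).add hd2
    simpa using this
  have hsum : ∑ a, x a = 0 := by
    have := aux_sum_antisymm Finset.univ T x
    simp_rw [hx, ← Finset.mul_sum] at this
    rcases mul_eq_zero.mp this with h | h
    · exfalso; norm_cast at h; omega
    · exact h
  refine ⟨?_, fun v hv => ?_⟩
  · have h1 : (μ : ℤ) ∣ ∑ a, (x w - x a) := Finset.dvd_sum fun a _ => hdiv a w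
    rw [Finset.sum_sub_distrib, hsum] at h1
    simp only [Finset.sum_const, Finset.card_univ, nsmul_eq_mul, sub_zero] at h1
    exact_mod_cast (hcop w).dvd_of_dvd_mul_right h1
  · have hxv : x v = 0 := by
      have := hxg v (Finset.mem_univ _)
      rw [hv] at this
      rcases mul_eq_zero.mp this.symm with h | h
      · exact absurd h hg
      · exact h
    have := hcop v
    rw [hxv, isCoprime_zero_right, Int.isUnit_iff] at this
    omega

theorem aux_real {V : Type*} [Fintype V] [DecidableEq V] (T : SimpleGraph V)
    [DecidableRel T.Adj] (hT : T.IsTree) (μ : ℕ) (hμ : 1 < μ) (x : V → ℝ) (hx : x ≠ 0)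
    (h : ∀ a, ∑ b, (if T.Adj a b then x a - x b else 0) = μ * x a) :
    μ ∣ Fintype.card V ∧ ∀ v, x v ≠ 0 := by
  obtain ⟨w, hw⟩ := Function.ne_iff.mp hx
  obtain ⟨f, hf⟩ : ∃ f : Module.Dual ℚ ℝ, f (x w) ≠ 0 := by
    by_contra! hc
    exact hw ((Module.forall_dual_apply_eq_zero_iff ℚ (x w)).mp hc)
  obtain ⟨d, hd⟩ := IsLocalization.exist_integer_multiples_of_finite (nonZeroDivisors ℤ)
    (fun v => f (x v))
  choose y hy using hd
  have hd0 : ((d : ℤ) : ℚ) ≠ 0 := by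
    exact_mod_cast nonZeroDivisors.ne_zero d.2
  have hy' : ∀ v, (y v : ℚ) = ((d : ℤ) : ℚ) * f (x v) := by
    intro v
    simpa [zsmul_eq_mul] using hy v
  have hfin := aux_int T hT μ hμ y (fun h0 => by
      have := hy' w
      rw [h0] at this
      simp [hf] at this) (fun a => by
      have h1 := congrArg (fun t => ((d : ℤ) : ℚ) * f t) (h a)
      simp only [map_sum, Finset.mul_sum] at h1
      have h2 : f ((μ : ℝ) * x a) = (μ : ℚ) * f (x a) := by
        rw [← nsmul_eq_mul, map_nsmul, nsmul_eq_mul]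
      rw [h2, mul_left_comm, ← hy'] at h1
      have h3 : ((∑ b, (if T.Adj a b then y a - y b else 0) : ℤ) : ℚ) = ((μ * y a : ℤ) : ℚ) := by
        push_cast
        rw [← h1]
        refine Finset.sum_congr rfl fun b _ => ?_
        split_ifs
        · rw [hy', hy', map_sub]; ring
        · simp
      exact_mod_cast h3)
  refine ⟨hfin.1, fun v hv => hfin.2 v ?_⟩
  have := hy' v
  rw [hv] at this
  simpa using this

theorem aux_lap {V : Type*} [Fintype V] [DecidableEq V] (T : SimpleGraph V)
    [DecidableRel T.Adj] (x : V → ℝ) (c : ℝ) (h : (T.lapMatrix ℝ) *ᵥ x = c • x) (a : V) :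
    ∑ b, (if T.Adj a b then x a - x b else 0) = c * x a := by
  have h1 := congrFun h a
  rw [lapMatrix_mulVec_apply] at h1
  simp only [Pi.smul_apply, smul_eq_mul] at h1
  rw [← h1, ← Finset.sum_filter, Finset.sum_sub_distrib, Finset.sum_const,
    ← neighborFinset_eq_filter, card_neighborFinset_eq_degree, nsmul_eq_mul]

theorem stmt_9 {V : Type*} [Fintype V] [DecidableEq V] (T : SimpleGraph V)
    [DecidableRel T.Adj] (hT : T.IsTree) (μ : ℕ) (hμ : 1 < μ)
    (hroot : (μ : ℝ) ∈ (T.lapMatrix ℝ).charpoly.roots) :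
    μ ∣ Fintype.card V ∧ (T.lapMatrix ℝ).charpoly.roots.count (μ : ℝ) = 1 := by
  have hH : (T.lapMatrix ℝ).IsHermitian := by
    have := T.isSymm_lapMatrix (R := ℝ)
    rw [Matrix.IsHermitian, Matrix.conjTranspose_eq_transpose_of_trivial]
    exact this
  have hev : ∀ i, hH.eigenvalues i = μ → ∀ a,
      ∑ b, (if T.Adj a b then hH.eigenvectorBasis i a - hH.eigenvectorBasis i b else 0)
        = μ * hH.eigenvectorBasis i a := by
    intro i hi
    have := hH.mulVec_eigenvectorBasis i
    rw [hi] at this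
    exact aux_lap T _ _ this
  have hne : ∀ i, (fun v => hH.eigenvectorBasis i v) ≠ 0 := by
    intro i h0
    apply hH.eigenvectorBasis.orthonormal.ne_zero i
    ext v
    exact congrFun h0 v
  have hroots : (T.lapMatrix ℝ).charpoly.roots = Finset.univ.val.map hH.eigenvalues := by
    rw [hH.roots_charpoly_eq_eigenvalues]
    rfl
  rw [hroots] at hroot ⊢
  obtain ⟨i, _, hi⟩ := Multiset.mem_map.mp hroot
  refine ⟨(aux_real T hT μ hμ _ (hne i) (hev i hi)).1, ?_⟩
  have huniq : ∀ j, hH.eigenvalues j = μ → j = i := by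
    intro j hj
    by_contra hji
    set p := fun v => hH.eigenvectorBasis i v with hp
    set q := fun v => hH.eigenvectorBasis j v with hq
    have hpi : p i ≠ 0 := (aux_real T hT μ hμ _ (hne i) (hev i hi)).2 i
    let z : V → ℝ := fun v => q i * p v - p i * q v
    have hz : z = 0 := by
      by_contra hz0
      refine (aux_real T hT μ hμ z hz0 (fun a => ?_)).2 i (by simp only [z]; ring)
      have e1 := hev i hi a
      have e2 := hev j hj a
      have : (μ : ℝ) * z a = q i * (μ * p a) - p i * (μ * q a) := by simp only [z]; ring
      rw [this, ← e1, ← e2, Finset.mul_sum, Finset.mul_sum, ← Finset.sum_sub_distrib]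
      refine Finset.sum_congr rfl fun b _ => ?_
      simp only [z, p, q]
      split_ifs <;> ring
    have hz' : q i • hH.eigenvectorBasis i - p i • hH.eigenvectorBasis j = 0 := by
      ext v
      exact congrFun hz v
    have hin := congrArg (fun t => inner ℝ (hH.eigenvectorBasis j) t) hz'
    have o1 := hH.eigenvectorBasis.orthonormal.2 hji
    have o2 := hH.eigenvectorBasis.orthonormal.1 j
    simp only [inner_sub_right, inner_smul_right, o1, real_inner_self_eq_norm_sq, o2,
      inner_zero_right] at hin
    apply hpi
    linarith
  rw [Multiset.count_map]
  have : (Multiset.filter (fun a => (μ : ℝ) = hH.eigenvalues a) Finset.univ.val)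
      = (Finset.univ.filter (fun a => (μ : ℝ) = hH.eigenvalues a)).val := rfl
  rw [this]
  change Finset.card _ = 1
  rw [Finset.card_eq_one]
  refine ⟨i, ?_⟩
  ext j
  simp only [Finset.mem_filter, Finset.mem_univ, true_and, Finset.mem_singleton]
  exact ⟨fun h => huniq j h.symm, fun h => h ▸ hi.symm⟩
end

section
/- If U is a unicyclic graph and λ > 1 is an integer signless Laplacian eigenvalue of U, then the multiplicity of λ as an eigenvalue of Q(U) is at most 2. -/
open Matrix SimpleGraph Polynomial

/-- Sum of the values of `x` on the endpoints of `e`. -/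
def edgeSum {V R : Type*} [Fintype V] [DecidableEq V] [CommRing R] (x : V → R) (e : Sym2 V) : R :=
  ∑ u, if u ∈ e then x u else 0

/-- Reduced incidence matrix, with edges indexed by the non-root vertices. -/
def redInc {V : Type*} [DecidableEq V] (T : SimpleGraph V) (v : V)
    (ε : {w // w ≠ v} ≃ T.edgeSet) (R : Type*) [CommRing R] :
    Matrix {w // w ≠ v} {w // w ≠ v} R :=
  fun w i => if (w : V) ∈ (ε i : Sym2 V) then 1 else 0

lemma edgeSum_mk {V R : Type*} [Fintype V] [DecidableEq V] [CommRing R] (x : V → R) (a b : V)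
    (h : a ≠ b) : edgeSum x s(a, b) = x a + x b := by
  unfold edgeSum
  rw [← Finset.sum_filter]
  have : (Finset.univ.filter fun u => u ∈ s(a, b)) = {a, b} := by
    ext u; simp
  rw [this, Finset.sum_pair h]

lemma redInc_transpose_mulVec {V R : Type*} [Fintype V] [DecidableEq V] [CommRing R]
    (T : SimpleGraph V) (v : V) (ε : {w // w ≠ v} ≃ T.edgeSet) (x : V → R) (hx : x v = 0)
    (i : {w // w ≠ v}) :
    ((redInc T v ε R)ᵀ *ᵥ (fun w => x w)) i = edgeSum x (ε i) := by
  unfold edgeSum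
  have h := Finset.sum_subtype_of_mem (p := fun w => w ≠ v) (s := Finset.univ.erase v)
    (fun u => if u ∈ (ε i : Sym2 V) then x u else 0) (by simp)
  rw [← Finset.add_sum_erase _ _ (Finset.mem_univ v)]
  simp only [hx, ite_self, zero_add]
  rw [← h]
  simp only [mulVec, dotProduct, transpose_apply, redInc, ite_mul, one_mul, zero_mul]
  apply Finset.sum_congr _ (fun _ _ => rfl)
  ext u
  simpa using u.2

lemma redInc_det_ne_zero {V K : Type*} [Fintype V] [DecidableEq V] [Field K]
    (T : SimpleGraph V) (hT : T.Connected) (v : V) (ε : {w // w ≠ v} ≃ T.edgeSet) :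
    (redInc T v ε K).det ≠ 0 := by
  intro h
  rw [← det_transpose, ← exists_mulVec_eq_zero_iff] at h
  obtain ⟨y, hy, h⟩ := h
  apply hy
  set Y : V → K := fun u => if h : u ≠ v then y ⟨u, h⟩ else 0 with hY
  have hv : Y v = 0 := by simp [hY]
  have hyY : y = fun w : {w // w ≠ v} => Y w := by
    funext w; simp [hY, w.2]
  have key : ∀ a b, T.Adj a b → Y a + Y b = 0 := by
    intro a b hab
    have := redInc_transpose_mulVec T v ε Y hv (ε.symm ⟨s(a, b), hab⟩)
    rw [← hyY, h, Equiv.apply_symm_apply, edgeSum_mk _ _ _ hab.ne] at this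
    exact this.symm
  have all : ∀ u, Y u = 0 := by
    intro u
    have walk : ∀ a b, T.Walk a b → Y b = 0 → Y a = 0 := by
      intro a b p
      induction p with
      | nil => exact id
      | cons hab p ih =>
        intro hb
        have h1 := key _ _ hab
        rwa [ih hb, add_zero] at h1
    obtain ⟨p⟩ := hT.preconnected u v
    exact walk _ _ p hv
  rw [hyY]; funext w; exact all w

lemma tree_charpoly {V : Type*} [Fintype V] [DecidableEq V]
    (T : SimpleGraph V) (hT : T.Connected) (v : V) (ε : {w // w ≠ v} ≃ T.edgeSet)
    (lam : ℤ) (hlam : 1 < lam) (x : V → ℝ) (hx : x v = 0)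
    (h : (redInc T v ε ℝ * (redInc T v ε ℝ)ᵀ) *ᵥ (fun w => x w) = (lam : ℝ) • (fun w : {w // w ≠ v} => x w)) :
    x = 0 := by
  by_contra hne
  obtain ⟨p, hp, hpl⟩ := Int.exists_prime_and_dvd (n := lam) (by omega)
  have : Fact (p.natAbs.Prime) := ⟨Int.prime_iff_natAbs_prime.mp hp⟩
  set M : Matrix {w // w ≠ v} {w // w ≠ v} ℤ := redInc T v ε ℤ * (redInc T v ε ℤ)ᵀ - lam • 1
    with hM
  have hmap : ∀ (R : Type) [CommRing R], (Int.castRingHom R).mapMatrix M =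
      redInc T v ε R * (redInc T v ε R)ᵀ - (lam : R) • 1 := by
    intro R _
    have h1 : (redInc T v ε ℤ).map (Int.castRingHom R) = redInc T v ε R := by
      ext i j; simp only [redInc, map_apply]; split_ifs <;> simp
    rw [hM, map_sub, map_mul]
    simp only [RingHom.mapMatrix_apply, transpose_map, h1]
    congr 1
    ext i j
    rw [map_apply, Matrix.smul_apply, Matrix.smul_apply, Matrix.one_apply, Matrix.one_apply]
    split_ifs <;> simp
  have hdet : M.det = 0 := by
    have : ((Int.castRingHom ℝ).mapMatrix M).det = 0 := by
      rw [← exists_mulVec_eq_zero_iff]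
      refine ⟨fun w => x w, ?_, ?_⟩
      · intro h0
        apply hne
        funext u
        by_cases hu : u = v
        · rw [hu, hx]; rfl
        · exact congrFun h0 ⟨u, hu⟩
      · rw [hmap, sub_mulVec, h, smul_mulVec, one_mulVec, sub_self]
    rw [← RingHom.map_det] at this
    simpa using this
  have h2 : ((Int.castRingHom (ZMod p.natAbs)).mapMatrix M).det = 0 := by
    rw [← RingHom.map_det, hdet, map_zero]
  have h3 : ((lam : ℤ) : ZMod p.natAbs) = 0 := by
    rw [ZMod.intCast_zmod_eq_zero_iff_dvd]
    exact Int.natAbs_dvd.mpr hpl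
  rw [hmap, h3, zero_smul, sub_zero, det_mul, det_transpose] at h2
  exact redInc_det_ne_zero T hT v ε (by simpa using h2)

lemma signless_mulVec {V : Type*} [Fintype V] [DecidableEq V] (U : SimpleGraph V)
    [DecidableRel U.Adj] [Fintype U.edgeSet] (x : V → ℝ) (w : V) :
    (signlessLaplacian U *ᵥ x) w = ∑ e ∈ U.edgeFinset, if w ∈ e then edgeSum x e else 0 := by
  have hQ : signlessLaplacian U = U.incMatrix ℝ * (U.incMatrix ℝ)ᵀ := by
    rw [incMatrix_mul_transpose]
    ext i j
    by_cases hij : i = j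
    · subst hij; simp [signlessLaplacian]
    · simp [signlessLaplacian, hij, adjMatrix_apply]
  rw [hQ, ← mulVec_mulVec]
  have : ∀ e, U.incMatrix ℝ w e * (((U.incMatrix ℝ)ᵀ *ᵥ x) e) =
      if e ∈ U.edgeFinset then (if w ∈ e then edgeSum x e else 0) else 0 := by
    intro e
    simp only [incMatrix_apply', incidenceSet, mulVec, dotProduct, transpose_apply, edgeSum]
    by_cases he : e ∈ U.edgeSet <;> simp [he]
  rw [mulVec, dotProduct, Finset.sum_congr rfl (fun e _ => this e)]
  rw [← Finset.sum_filter]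
  congr 1
  ext e
  simp

lemma exists_eigvec {V : Type*} [Fintype V] [DecidableEq V] (A : Matrix V V ℝ)
    (hA : A.IsHermitian) (l : ℝ) (h : 2 < A.charpoly.roots.count l)
    (f : (V → ℝ) →ₗ[ℝ] (ℝ × ℝ)) : ∃ x : V → ℝ, x ≠ 0 ∧ A *ᵥ x = l • x ∧ f x = 0 := by
  rw [hA.roots_charpoly_eq_eigenvalues, Multiset.count_map] at h
  have hc : 2 < Fintype.card {i // hA.eigenvalues i = l} := by
    rw [Fintype.card_subtype]
    refine h.trans_eq ?_
    rw [Finset.card_def, Finset.filter_val]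
    congr 1
    apply Multiset.filter_congr
    simp [eq_comm]
  let b : {i // hA.eigenvalues i = l} → (V → ℝ) := fun i => ⇑(hA.eigenvectorBasis i)
  have hb : LinearIndependent ℝ b := by
    have h1 := hA.eigenvectorBasis.toBasis.linearIndependent
    have h2 := h1.map' (WithLp.linearEquiv 2 ℝ (V → ℝ)).toLinearMap (LinearEquiv.ker _)
    have h3 := h2.comp (fun i : {i // hA.eigenvalues i = l} => (i : V)) Subtype.val_injective
    have h4 : b = ((⇑(WithLp.linearEquiv 2 ℝ (V → ℝ)).toLinearMap ∘
        ⇑hA.eigenvectorBasis.toBasis) ∘ fun i : {i // hA.eigenvalues i = l} => (i : V)) := by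
      funext i
      simp [b]
    rw [h4]
    exact h3
  let g := Fintype.linearCombination ℝ b
  have hk : LinearMap.ker (f ∘ₗ g) ≠ ⊥ := by
    apply LinearMap.ker_ne_bot_of_finrank_lt
    simpa using hc
  obtain ⟨c, hc, hc0⟩ := Submodule.exists_mem_ne_zero_of_ne_bot hk
  refine ⟨g c, ?_, ?_, hc⟩
  · intro h0
    apply hc0
    funext i
    exact Fintype.linearIndependent_iff.mp hb c h0 i
  · simp only [g, Fintype.linearCombination_apply, Finset.smul_sum]
    rw [Matrix.mulVec_sum]
    apply Finset.sum_congr rfl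
    intro i _
    rw [mulVec_smul, hA.mulVec_eigenvectorBasis, i.2, smul_comm]

theorem stmt_11 {V : Type*} [Fintype V] [DecidableEq V] (U : SimpleGraph V)
    [DecidableRel U.Adj] [Fintype U.edgeSet]
    (hU : U.Connected ∧ U.edgeFinset.card = Fintype.card V)
    (lam : ℤ) (hlam : 1 < lam)
    (hroot : ((lam : ℝ)) ∈ (signlessLaplacian U).charpoly.roots) :
    (signlessLaplacian U).charpoly.roots.count ((lam : ℝ)) ≤ 2 := by
  classical
  by_contra! hcon
  obtain ⟨hconn, hcard⟩ := hU
  obtain ⟨T, hTU, hT⟩ := hconn.exists_isTree_le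
  have hTc := hT.card_edgeFinset
  have hsub : T.edgeFinset ⊆ U.edgeFinset := edgeFinset_mono hTU
  have hd : (U.edgeFinset \ T.edgeFinset).card = 1 := by
    rw [Finset.card_sdiff_of_subset hsub]; omega
  obtain ⟨e0, he0⟩ := Finset.card_eq_one.mp hd
  obtain ⟨v⟩ := hconn.nonempty
  have hherm : (signlessLaplacian U).IsHermitian := by
    unfold signlessLaplacian
    apply IsHermitian.add
    · exact isHermitian_diagonal _
    · ext i j
      simp [adjMatrix_apply, U.adj_comm]
  let f : (V → ℝ) →ₗ[ℝ] (ℝ × ℝ) :=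
    { toFun := fun x => (x v, edgeSum x e0)
      map_add' := by
        intro x y
        ext
        · rfl
        · simp only [edgeSum, Prod.snd_add, ← Finset.sum_add_distrib]
          apply Finset.sum_congr rfl
          intro u _
          split_ifs <;> simp
      map_smul' := by
        intro c x
        ext
        · rfl
        · simp [edgeSum, Finset.mul_sum] }
  obtain ⟨x, hx0, hx, hfx⟩ := exists_eigvec _ hherm _ hcon f
  have hxv : x v = 0 := congrArg Prod.fst hfx
  have hxe : edgeSum x e0 = 0 := congrArg Prod.snd hfx
  have hcard2 : Fintype.card {w // w ≠ v} = Fintype.card T.edgeSet := by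
    rw [← edgeFinset_card, Fintype.card_subtype_compl, Fintype.card_subtype_eq]
    omega
  let ε := Fintype.equivOfCardEq hcard2
  apply hx0
  refine tree_charpoly T hT.connected v ε lam hlam x hxv ?_
  funext w
  have h1 := congrFun hx w
  rw [signless_mulVec, ← Finset.sum_sdiff hsub, he0, Finset.sum_singleton, hxe, ite_self,
    zero_add] at h1
  have h2 : (redInc T v ε ℝ)ᵀ *ᵥ (fun w => x w) = fun i => edgeSum x (ε i) :=
    funext (redInc_transpose_mulVec T v ε x hxv)
  rw [← mulVec_mulVec, h2]
  refine Eq.trans ?_ h1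
  simp only [mulVec, dotProduct, redInc, ite_mul, one_mul, zero_mul]
  rw [Equiv.sum_comp ε (fun e : T.edgeSet => if (w : V) ∈ (e : Sym2 V) then edgeSum x e else 0)]
  symm
  apply Finset.sum_subtype
  simp
end

section
/- The graphs K₃ ∪ K₂ ∪ rK₁ and K_{1,3} ∪ K₂ ∪ (r−1)K₁ (for r ≥ 1) are signless-Laplacian cospectral but not isomorphic. -/
open Matrix SimpleGraph Polynomial

/-- K₃ ∪ K₂ ∪ r·K₁ on the vertex set Fin (r+5): a triangle on {0,1,2},
an edge {3,4}, and r isolated vertices. -/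
def graphA (r : ℕ) : SimpleGraph (Fin (r + 5)) :=
  SimpleGraph.fromRel (fun a b =>
    ((a : ℕ) < 3 ∧ (b : ℕ) < 3) ∨ ((a : ℕ) = 3 ∧ (b : ℕ) = 4))

/-- K_{1,3} ∪ K₂ ∪ (r−1)·K₁ on the vertex set Fin (r+5): a star with center 0
and leaves 1,2,3, an edge {4,5}, and r−1 isolated vertices (requires r ≥ 1). -/
def graphB (r : ℕ) : SimpleGraph (Fin (r + 5)) :=
  SimpleGraph.fromRel (fun a b =>
    ((a : ℕ) = 0 ∧ 1 ≤ (b : ℕ) ∧ (b : ℕ) ≤ 3) ∨ ((a : ℕ) = 4 ∧ (b : ℕ) = 5))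

instance (r : ℕ) : DecidableRel (graphA r).Adj := fun a b => by
  unfold graphA; exact inferInstanceAs (Decidable (_ ∧ _))

instance (r : ℕ) : DecidableRel (graphB r).Adj := fun a b => by
  unfold graphB; exact inferInstanceAs (Decidable (_ ∧ _))

/-- Vertex-edge incidence matrix with four edges `a e — b e`. -/
noncomputable def incM (n : ℕ) (a b : Fin 4 → ℕ) : Matrix (Fin n) (Fin 4) ℝ :=
  fun i e => if (i : ℕ) = a e ∨ (i : ℕ) = b e then 1 else 0

theorem lt_three (x : ℕ) : x < 3 ↔ x = 0 ∨ x = 1 ∨ x = 2 := by omega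
theorem lt_five (x : ℕ) : x < 5 ↔ x = 0 ∨ x = 1 ∨ x = 2 ∨ x = 3 ∨ x = 4 := by omega
theorem lt_six (x : ℕ) : x < 6 ↔ x = 0 ∨ x = 1 ∨ x = 2 ∨ x = 3 ∨ x = 4 ∨ x = 5 := by omega
theorem mid_three (x : ℕ) : (1 ≤ x ∧ x ≤ 3) ↔ x = 1 ∨ x = 2 ∨ x = 3 := by omega

theorem adjA (r : ℕ) (i j : Fin (r + 5)) : (graphA r).Adj i j ↔ ¬ (i : ℕ) = (j : ℕ) ∧
    ((((i : ℕ) < 3 ∧ (j : ℕ) < 3) ∨ ((i : ℕ) = 3 ∧ (j : ℕ) = 4)) ∨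
     (((j : ℕ) < 3 ∧ (i : ℕ) < 3) ∨ ((j : ℕ) = 3 ∧ (i : ℕ) = 4))) := by
  simp only [graphA, SimpleGraph.fromRel_adj, ne_eq, Fin.ext_iff]

theorem adjB (r : ℕ) (i j : Fin (r + 5)) : (graphB r).Adj i j ↔ ¬ (i : ℕ) = (j : ℕ) ∧
    ((((i : ℕ) = 0 ∧ 1 ≤ (j : ℕ) ∧ (j : ℕ) ≤ 3) ∨ ((i : ℕ) = 4 ∧ (j : ℕ) = 5)) ∨
     (((j : ℕ) = 0 ∧ 1 ≤ (i : ℕ) ∧ (i : ℕ) ≤ 3) ∨ ((j : ℕ) = 4 ∧ (i : ℕ) = 5))) := by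
  simp only [graphB, SimpleGraph.fromRel_adj, ne_eq, Fin.ext_iff]

theorem degA (s : ℕ) (i : Fin (s + 1 + 5)) :
    (graphA (s + 1)).degree i = if (i : ℕ) < 3 then 2 else if (i : ℕ) < 5 then 1 else 0 := by
  rw [← SimpleGraph.card_neighborFinset_eq_degree, SimpleGraph.neighborFinset_eq_filter,
    Finset.card_filter]
  simp only [Fin.sum_univ_succ, adjA, Fin.val_succ,
    Fin.val_zero, lt_three, lt_five, lt_six, mid_three]
  rcases i with ⟨i, hi⟩
  rcases i with _ | _ | _ | _ | _ | _ | i <;> simp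

theorem degB (s : ℕ) (i : Fin (s + 1 + 5)) :
    (graphB (s + 1)).degree i = if (i : ℕ) = 0 then 3 else if (i : ℕ) < 6 then 1 else 0 := by
  rw [← SimpleGraph.card_neighborFinset_eq_degree, SimpleGraph.neighborFinset_eq_filter,
    Finset.card_filter]
  simp only [Fin.sum_univ_succ, adjB, Fin.val_succ,
    Fin.val_zero, lt_three, lt_five, lt_six, mid_three]
  rcases i with ⟨i, hi⟩
  rcases i with _ | _ | _ | _ | _ | _ | i <;> simp

theorem QA (s : ℕ) : signlessLaplacian (graphA (s + 1)) =
    incM (s + 1 + 5) ![0, 0, 1, 3] ![1, 2, 2, 4] *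
      (incM (s + 1 + 5) ![0, 0, 1, 3] ![1, 2, 2, 4])ᵀ := by
  ext i j
  simp only [signlessLaplacian, Matrix.add_apply, Matrix.diagonal_apply, degA,
    SimpleGraph.adjMatrix_apply, Matrix.mul_apply, Matrix.transpose_apply, incM,
    Fin.sum_univ_four, adjA, Fin.ext_iff, lt_three, lt_five, lt_six, mid_three]
  rcases i with ⟨i, hi⟩
  rcases j with ⟨j, hj⟩
  rcases i with _ | _ | _ | _ | _ | _ | i <;> rcases j with _ | _ | _ | _ | _ | _ | j <;>
    simp <;> norm_num

theorem QB (s : ℕ) : signlessLaplacian (graphB (s + 1)) =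
    incM (s + 1 + 5) ![0, 0, 0, 4] ![1, 2, 3, 5] *
      (incM (s + 1 + 5) ![0, 0, 0, 4] ![1, 2, 3, 5])ᵀ := by
  ext i j
  simp only [signlessLaplacian, Matrix.add_apply, Matrix.diagonal_apply, degB,
    SimpleGraph.adjMatrix_apply, Matrix.mul_apply, Matrix.transpose_apply, incM,
    Fin.sum_univ_four, adjB, Fin.ext_iff, lt_three, lt_five, lt_six, mid_three]
  rcases i with ⟨i, hi⟩
  rcases j with ⟨j, hj⟩
  rcases i with _ | _ | _ | _ | _ | _ | i <;> rcases j with _ | _ | _ | _ | _ | _ | j <;>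
    simp <;> norm_num

/-- The triangle and the claw have the same line graph. -/
theorem gram_eq (s : ℕ) :
    (incM (s + 1 + 5) ![0, 0, 1, 3] ![1, 2, 2, 4])ᵀ * incM (s + 1 + 5) ![0, 0, 1, 3] ![1, 2, 2, 4] =
    (incM (s + 1 + 5) ![0, 0, 0, 4] ![1, 2, 3, 5])ᵀ *
      incM (s + 1 + 5) ![0, 0, 0, 4] ![1, 2, 3, 5] := by
  ext e f
  simp only [Matrix.mul_apply, Matrix.transpose_apply, incM, Fin.sum_univ_succ, Fin.val_succ,
    Fin.val_zero]
  fin_cases e <;> fin_cases f <;> simp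

theorem stmt_18 (r : ℕ) (hr : 1 ≤ r) :
    (signlessLaplacian (graphA r)).charpoly = (signlessLaplacian (graphB r)).charpoly ∧
      ¬ Nonempty (graphA r ≃g graphB r) := by
  obtain ⟨s, rfl⟩ : ∃ s, r = s + 1 := ⟨r - 1, by omega⟩
  constructor
  · have hA := Matrix.charpoly_mul_comm' (incM (s + 1 + 5) ![0, 0, 1, 3] ![1, 2, 2, 4])
      (incM (s + 1 + 5) ![0, 0, 1, 3] ![1, 2, 2, 4])ᵀ
    have hB := Matrix.charpoly_mul_comm' (incM (s + 1 + 5) ![0, 0, 0, 4] ![1, 2, 3, 5])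
      (incM (s + 1 + 5) ![0, 0, 0, 4] ![1, 2, 3, 5])ᵀ
    rw [← QA, gram_eq, ← hB, ← QB] at hA
    exact mul_left_cancel₀ (pow_ne_zero _ Polynomial.X_ne_zero) hA
  · rintro ⟨φ⟩
    have h := φ.degree_eq (φ.symm 0)
    rw [RelIso.apply_symm_apply, degA, degB] at h
    simp only [Fin.val_zero, if_true] at h
    split_ifs at h <;> omega
end
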